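/- Let D be a finite directed multigraph and let m : E(D) → ℤ_{≥0} be a nonnegative-integer edge weighting that is positive on every directed cycle of D. Define m♭ by m♭(e) = min(m(e), 1) for each edge e. Then m♭ is positive on every directed cycle of D and gr_D(m) ≤ gr_D(m♭). Consequently, the set of growth rates gr_D(m), taken over all nonnegative-integer edge weightings m of D that are positive on every directed cycle, is bounded above (by the maximum of gr_D(m') over the finitely many {0,1}-valued edge weightings m' positive on every directed cycle). -/

import Mathlib

/-- A finite directed multigraph on vertex type `V` and edge type `E`:
each edge has a source and a target vertex (loops and parallel edges allowed). -/
structure Multidigraph (V E : Type) where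
  src : E → V
  tgt : E → V

namespace Multidigraph

variable {V E : Type} (D : Multidigraph V E)

/-- A cycle word: a nonempty list of edges that is cyclically composable. -/
def IsCycleWord (l : List E) : Prop :=
  l ≠ [] ∧ ∀ i j : Fin l.length, ((i : ℕ) + 1) % l.length = (j : ℕ) →
    D.tgt (l.get i) = D.src (l.get j)

/-- Cycle words up to cyclic rotation. -/
def cycleSetoid : Setoid { l : List E // D.IsCycleWord l } where
  r a b := List.IsRotated a.1 b.1
  iseqv := ⟨fun a => List.IsRotated.refl a.1, fun h => h.symm, fun h h' => h.trans h'⟩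

/-- A directed cycle of `D`: a cycle word considered up to cyclic rotation. -/
def Cycle := Quotient D.cycleSetoid

/-- The value of an edge weighting on a directed cycle: the sum of the weights
of the edges it traverses. -/
noncomputable def weight (α : E → ℝ) (c : D.Cycle) : ℝ :=
  Quotient.lift (fun l : { l : List E // D.IsCycleWord l } => (l.1.map α).sum)
    (fun a b h => by
      have h' : List.IsRotated a.1 b.1 := h
      exact List.Perm.sum_eq (List.Perm.map α (List.IsRotated.perm h'))) c

/-- An edge lies on a directed cycle. -/
def EdgeMem (e : E) (c : D.Cycle) : Prop :=
  ∃ l : { l : List E // D.IsCycleWord l }, Quotient.mk D.cycleSetoid l = c ∧ e ∈ l.1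

/-- A directed cycle is contained in the subgraph with edge set `E'`. -/
def CycleIn (E' : Set E) (c : D.Cycle) : Prop :=
  ∀ e : E, D.EdgeMem e c → e ∈ E'

/-- The growth rate of the directed cycles contained in the subgraph with edge set `E'`,
counted with respect to the edge weighting `α`:
`limsup_{L → ∞} (#{cycles γ in the subgraph with α(γ) ≤ L})^(1/L)`. -/
noncomputable def growthRateOn (E' : Set E) (α : E → ℝ) : ℝ :=
  Filter.limsup
    (fun L : ℝ =>
      (Nat.card { c : D.Cycle | D.CycleIn E' c ∧ D.weight α c ≤ L } : ℝ) ^ (1 / L))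
    Filter.atTop

/-- The growth rate of all directed cycles of `D` with respect to `α`. -/
noncomputable def growthRate (α : E → ℝ) : ℝ :=
  D.growthRateOn Set.univ α

end Multidigraph

namespace Multidigraph

variable {V E : Type} (D : Multidigraph V E)

theorem isCycleWord_of_chain (e : E) (b : List E)
    (h : List.IsChain (fun x y => D.tgt x = D.src y) ((e :: b) ++ [e])) :
    D.IsCycleWord (e :: b) := by
  refine ⟨by simp, ?_⟩
  intro i j hij
  rw [List.isChain_iff_getElem] at h
  have hi := i.2
  have h1 := h i.1 (by simp at hi ⊢; omega)
  rw [List.getElem_append_left hi] at h1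
  simp only [List.get_eq_getElem]
  rw [h1]
  congr 1
  by_cases hlt : i.1 + 1 < (e :: b).length
  · rw [List.getElem_append_left hlt]
    rw [Nat.mod_eq_of_lt hlt] at hij
    congr 1
  · have heq : i.1 + 1 = (e :: b).length := by omega
    rw [heq, Nat.mod_self] at hij
    rw [List.getElem_append_right (by omega)]
    simp [← hij]

theorem IsCycleWord.chain {l : List E} (h : D.IsCycleWord l) :
    List.IsChain (fun x y => D.tgt x = D.src y) l := by
  rw [List.isChain_iff_getElem]
  intro i hi
  exact h.2 ⟨i, by omega⟩ ⟨i + 1, hi⟩ (Nat.mod_eq_of_lt hi)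

theorem weight_mk (m : E → ℕ) (l : { l : List E // D.IsCycleWord l }) :
    D.weight (fun e => (m e : ℝ)) (Quotient.mk D.cycleSetoid l) = ((l.1.map m).sum : ℕ) := by
  rw [Nat.cast_list_sum, List.map_map]
  rfl

theorem pos_word (m : E → ℕ) (hm : ∀ c : D.Cycle, 0 < D.weight (fun e => (m e : ℝ)) c)
    (l : List E) (hl : D.IsCycleWord l) : 0 < (l.map m).sum := by
  have := hm (Quotient.mk D.cycleSetoid ⟨l, hl⟩)
  rw [weight_mk] at this
  exact_mod_cast this

theorem pos_chain [Fintype E] (m : E → ℕ)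
    (hm : ∀ c : D.Cycle, 0 < D.weight (fun e => (m e : ℝ)) c)
    (l : List E) (hl : List.IsChain (fun x y => D.tgt x = D.src y) l)
    (hlen : Fintype.card E < l.length) : 0 < (l.map m).sum := by
  have hnd : ¬ l.Nodup := fun h => by
    have := h.length_le_card
    omega
  rw [List.nodup_iff_sublist] at hnd
  push Not at hnd
  obtain ⟨e, he⟩ := hnd
  rw [List.cons_sublist_iff] at he
  obtain ⟨r1, r2, rfl, h1, h2⟩ := he
  rw [List.singleton_sublist] at h2
  obtain ⟨s, t, rfl⟩ := List.append_of_mem h1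
  obtain ⟨u, v, rfl⟩ := List.append_of_mem h2
  have hc : D.IsCycleWord (e :: (t ++ u)) := by
    apply isCycleWord_of_chain
    apply hl.infix
    exact ⟨s, v, by simp⟩
  have := pos_word D m hm _ hc
  simp at this ⊢
  omega

theorem length_lt [Fintype E] (m : E → ℕ)
    (hm : ∀ c : D.Cycle, 0 < D.weight (fun e => (m e : ℝ)) c) (n : ℕ) :
    ∀ l : List E, l.length ≤ n → List.IsChain (fun x y => D.tgt x = D.src y) l →
    l.length < (Fintype.card E + 1) * ((l.map m).sum + 1) := by
  induction n with
  | zero =>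
    intro l hl _
    have : l.length = 0 := by omega
    rw [this]; positivity
  | succ n ih =>
    intro l hl hc
    by_cases h : l.length < Fintype.card E + 1
    · nlinarith [Nat.zero_le ((Fintype.card E + 1) * (l.map m).sum)]
    · have h1 := pos_chain D m hm (l.take (Fintype.card E + 1))
        (hc.infix (List.take_prefix _ _).isInfix) (by simp; omega)
      have h2 := ih (l.drop (Fintype.card E + 1)) (by simp; omega)
        (hc.infix (List.drop_suffix _ _).isInfix)
      have h3 : (l.map m).sum = ((l.take (Fintype.card E + 1)).map m).sum +
          ((l.drop (Fintype.card E + 1)).map m).sum := by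
        rw [← List.sum_append, ← List.map_append, List.take_append_drop]
      rw [h3]
      rw [List.length_drop] at h2
      have h4 : l.length < (Fintype.card E + 1) *
        (((l.drop (Fintype.card E + 1)).map m).sum + 1) + (Fintype.card E + 1) := by omega
      nlinarith

theorem count_le [Fintype E] (m : E → ℕ)
    (hm : ∀ c : D.Cycle, 0 < D.weight (fun e => (m e : ℝ)) c) (L : ℝ) :
    Finite { c : D.Cycle | D.CycleIn Set.univ c ∧ D.weight (fun e => (m e : ℝ)) c ≤ L } ∧
    Nat.card { c : D.Cycle | D.CycleIn Set.univ c ∧ D.weight (fun e => (m e : ℝ)) c ≤ L } ≤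
      (Fintype.card E + 1) ^ ((Fintype.card E + 1) * (⌊L⌋₊ + 1)) := by
  set N := (Fintype.card E + 1) * (⌊L⌋₊ + 1) with hN
  have hlen : ∀ c : { c : D.Cycle | D.CycleIn Set.univ c ∧ D.weight (fun e => (m e : ℝ)) c ≤ L },
      (Quotient.out c.1).1.length ≤ N := by
    intro c
    have h1 := c.2.2
    rw [← Quotient.out_eq c.1, weight_mk] at h1
    have h2 := Nat.le_floor h1
    have h3 := length_lt D m hm _ _ le_rfl (Quotient.out c.1).2.chain
    refine h3.le.trans ?_
    rw [hN]
    gcongr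
  let f : { c : D.Cycle | D.CycleIn Set.univ c ∧ D.weight (fun e => (m e : ℝ)) c ≤ L } →
      (Fin N → Option E) := fun c i => (Quotient.out c.1).1[i.1]?
  have hf : Function.Injective f := by
    intro c d hcd
    apply Subtype.ext
    apply Quotient.out_injective
    apply Subtype.ext
    apply List.ext_getElem?
    intro i
    by_cases hi : i < N
    · exact congrFun hcd ⟨i, hi⟩
    · rw [List.getElem?_eq_none (by have := hlen c; omega),
        List.getElem?_eq_none (by have := hlen d; omega)]
  refine ⟨Finite.of_injective f hf, ?_⟩
  have := Nat.card_le_card_of_injective f hf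
  simpa using this

theorem root_le [Fintype E] (m : E → ℕ)
    (hm : ∀ c : D.Cycle, 0 < D.weight (fun e => (m e : ℝ)) c) (L : ℝ) (hL : 1 ≤ L) :
    (Nat.card { c : D.Cycle | D.CycleIn Set.univ c ∧
      D.weight (fun e => (m e : ℝ)) c ≤ L } : ℝ) ^ (1 / L) ≤
      ((Fintype.card E + 1 : ℕ) : ℝ) ^ (2 * ((Fintype.card E + 1 : ℕ) : ℝ)) := by
  have h := (count_le D m hm L).2
  set K := Fintype.card E + 1 with hK
  have hK1 : (1 : ℝ) ≤ (K : ℝ) := by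
    rw [hK]; push_cast; linarith [Nat.cast_nonneg (α := ℝ) (Fintype.card E)]
  have hL0 : 0 < L := by linarith
  have h' : (Nat.card { c : D.Cycle | D.CycleIn Set.univ c ∧
      D.weight (fun e => (m e : ℝ)) c ≤ L } : ℝ) ≤ (K : ℝ) ^ (K * (⌊L⌋₊ + 1)) := by
    exact_mod_cast h
  calc _ ≤ ((K : ℝ) ^ (K * (⌊L⌋₊ + 1))) ^ (1 / L) :=
        Real.rpow_le_rpow (Nat.cast_nonneg _) h' (by positivity)
    _ = (K : ℝ) ^ (((K * (⌊L⌋₊ + 1) : ℕ) : ℝ) * (1 / L)) := by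
        rw [Real.rpow_mul (by positivity), Real.rpow_natCast]
    _ ≤ _ := by
        apply Real.rpow_le_rpow_of_exponent_le hK1
        rw [mul_one_div, div_le_iff₀ hL0]
        push_cast
        have := Nat.floor_le hL0.le
        nlinarith

theorem trunc_pos (m : E → ℕ) (hm : ∀ c : D.Cycle, 0 < D.weight (fun e => (m e : ℝ)) c)
    (c : D.Cycle) : 0 < D.weight (fun e => ((min (m e) 1 : ℕ) : ℝ)) c := by
  induction c using Quotient.inductionOn with
  | _ l =>
    have h := pos_word D m hm l.1 l.2
    rw [weight_mk D (fun e => min (m e) 1) l]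
    rw [Nat.cast_pos]
    by_contra h0
    have h0 : (l.1.map (fun e => min (m e) 1)).sum = 0 := by omega
    rw [List.sum_eq_zero_iff] at h0
    have : (l.1.map m).sum = 0 := by
      rw [List.sum_eq_zero_iff]
      intro x hx
      obtain ⟨e, he, rfl⟩ := List.mem_map.1 hx
      have := h0 _ (List.mem_map.2 ⟨e, he, rfl⟩)
      omega
    omega

theorem weight_trunc_le (m : E → ℕ) (c : D.Cycle) :
    D.weight (fun e => ((min (m e) 1 : ℕ) : ℝ)) c ≤ D.weight (fun e => (m e : ℝ)) c := by
  induction c using Quotient.inductionOn with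
  | _ l =>
    apply List.sum_le_sum
    intro e _
    exact_mod_cast min_le_left _ _

theorem bdd_under [Fintype E] (m : E → ℕ)
    (hm : ∀ c : D.Cycle, 0 < D.weight (fun e => (m e : ℝ)) c) :
    ∀ᶠ L : ℝ in Filter.atTop, (Nat.card { c : D.Cycle | D.CycleIn Set.univ c ∧
      D.weight (fun e => (m e : ℝ)) c ≤ L } : ℝ) ^ (1 / L) ≤
      ((Fintype.card E + 1 : ℕ) : ℝ) ^ (2 * ((Fintype.card E + 1 : ℕ) : ℝ)) := by
  filter_upwards [Filter.eventually_ge_atTop 1] with L hL using root_le D m hm L hL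

theorem cobdd_under (α : E → ℝ) :
    Filter.IsCoboundedUnder (· ≤ ·) Filter.atTop
      (fun L : ℝ => (Nat.card { c : D.Cycle | D.CycleIn Set.univ c ∧
      D.weight α c ≤ L } : ℝ) ^ (1 / L)) := by
  refine Filter.isCoboundedUnder_le_of_le Filter.atTop (x := 0) (fun L => ?_)
  positivity

end Multidigraph

/-- Let `m` be a nonnegative-integer edge weighting of the finite
directed multigraph `D` that is positive on every directed cycle, and let
`m♭(e) = min (m e) 1`.  Then `m♭` is positive on every directed cycle,
`gr_D(m) ≤ gr_D(m♭)`, and consequently the set of growth rates of nonnegative-integer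
edge weightings positive on every directed cycle is bounded above. -/
theorem growthRate_le_truncation_and_bddAbove
    {V E : Type} [Fintype V] [Fintype E] (D : Multidigraph V E)
    (m : E → ℕ) (hm : ∀ c : D.Cycle, 0 < D.weight (fun e => (m e : ℝ)) c) :
    (∀ c : D.Cycle, 0 < D.weight (fun e => ((min (m e) 1 : ℕ) : ℝ)) c) ∧
      D.growthRate (fun e => (m e : ℝ)) ≤
        D.growthRate (fun e => ((min (m e) 1 : ℕ) : ℝ)) ∧
      BddAbove { x : ℝ | ∃ m' : E → ℕ,
        (∀ c : D.Cycle, 0 < D.weight (fun e => (m' e : ℝ)) c) ∧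
          x = D.growthRate (fun e => (m' e : ℝ)) } := by
  refine ⟨D.trunc_pos m hm, ?_, ?_⟩
  · apply Filter.limsup_le_limsup
    · filter_upwards [Filter.eventually_ge_atTop 1] with L hL
      have hfin := (D.count_le (fun e => min (m e) 1) (D.trunc_pos m hm) L).1
      apply Real.rpow_le_rpow (Nat.cast_nonneg _) _ (by positivity)
      rw [Nat.cast_le]
      refine Nat.card_mono hfin ?_
      rintro c ⟨hc1, hc2⟩
      exact ⟨hc1, (D.weight_trunc_le m c).trans hc2⟩
    · exact D.cobdd_under _
    · exact ⟨_, Filter.eventually_map.2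
        (D.bdd_under (fun e => min (m e) 1) (D.trunc_pos m hm))⟩
  · refine ⟨((Fintype.card E + 1 : ℕ) : ℝ) ^ (2 * ((Fintype.card E + 1 : ℕ) : ℝ)), ?_⟩
    rintro x ⟨m', hm', rfl⟩
    exact Filter.limsup_le_of_le (D.cobdd_under _) (D.bdd_under m' hm')
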